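/- Let N, k be natural numbers, let u be a complex number, and let x_1, …, x_k be nonzero, pairwise distinct complex numbers with x_i x_j ≠ 1 for all 1 ≤ i ≤ j ≤ k. Then ∑_{λ ⊆ ⟨(2N)^k⟩} u^{r(λ)} · s_λ(x_1, …, x_k) = ∑_{ε ∈ {±1}^k} (∏_{j=1}^{k} x_j^{N(1−ε_j)}) · ( ∏_{i=1}^{k} (1 + x_i^{ε_i} u) ) / ( ∏_{1 ≤ i ≤ j ≤ k} (1 − x_i^{ε_i} x_j^{ε_j}) ), where the left-hand sum is over all partitions λ with at most k parts, each part at most 2N, and r(λ) denotes the number of odd parts of λ. -/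

import Mathlib

open MeasureTheory Matrix Finset

noncomputable section

instance matrixMeasurableSpace {m n R : Type*} [MeasurableSpace R] :
    MeasurableSpace (Matrix m n R) :=
  MeasurableSpace.pi

/-- The Schur polynomial `s_λ(a_1, …, a_n)` attached to a partition `λ` with at most `n`
parts, evaluated at `a_1, …, a_n`, as the ratio of the two determinants
`det(a_i^{λ_j + n - j}) / det(a_i^{n - j})` (with `1 ≤ j ≤ n`; here columns are
`0`-indexed, so the exponents read `λ_j + (n - 1 - j)` and `n - 1 - j`). -/
def schur {n : ℕ} (lam : Fin n → ℕ) (a : Fin n → ℂ) : ℂ :=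
  Matrix.det (Matrix.of fun i j : Fin n => a i ^ (lam j + (n - 1 - (j : ℕ)))) /
    Matrix.det (Matrix.of fun i j : Fin n => a i ^ (n - 1 - (j : ℕ)))

/-- The entries of a sign vector `ε ∈ {±1}^k`, encoded by a Boolean vector:
`sg ε j = 1` if `ε j = true` and `sg ε j = -1` otherwise. -/
def sg {k : ℕ} (ε : Fin k → Bool) (j : Fin k) : ℤ := if ε j then 1 else -1

/-- Expansion of a product over pairs `i ≤ j` of a symmetric function by splitting off the pairs
containing `p`. -/
lemma prod_Ici_succAbove {n : ℕ} (f : Fin (n + 1) → Fin (n + 1) → ℂ)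
    (hf : ∀ i j, f i j = f j i) (p : Fin (n + 1)) :
    ∏ i, ∏ j ∈ Ici i, f i j = (f p p * ∏ l, f p (p.succAbove l)) *
      ∏ i, ∏ j ∈ Ici i, f (p.succAbove i) (p.succAbove j) := by
  have key : ∀ {m : ℕ} (g : Fin m → Fin m → ℂ) (i : Fin m),
      ∏ j ∈ Ici i, g i j = ∏ j, if i ≤ j then g i j else 1 := by
    intro m g i
    rw [← prod_filter]
    congr 1
    ext j
    simp
  simp_rw [key f, key fun i j => f (p.succAbove i) (p.succAbove j)]
  rw [Fin.prod_univ_succAbove _ p, Fin.prod_univ_succAbove _ p]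
  simp_rw [Fin.prod_univ_succAbove (fun j => if _ ≤ j then f _ j else 1) p]
  rw [prod_mul_distrib, if_pos le_rfl]
  simp_rw [(Fin.strictMono_succAbove p).le_iff_le]
  rw [← mul_assoc, mul_assoc (f p p), ← prod_mul_distrib]
  congr 2
  refine prod_congr rfl fun l _ => ?_
  rcases lt_or_gt_of_ne (Fin.succAbove_ne p l) with h | h
  · rw [if_neg h.not_ge, if_pos h.le, hf, one_mul]
  · rw [if_pos h.le, if_neg h.not_ge, mul_one]

/-- The reversed Vandermonde determinant. -/
def revVandermonde {n : ℕ} (x : Fin n → ℂ) : ℂ :=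
  Matrix.det (Matrix.of fun i j : Fin n => x i ^ (n - 1 - (j : ℕ)))

lemma revVandermonde_eq_prod {n : ℕ} (x : Fin n → ℂ) :
    revVandermonde x = ∏ i, ∏ j ∈ Ioi i, (x i - x j) := by
  have h := Matrix.det_projVandermonde (1 : Fin n → ℂ) x
  simp only [Pi.one_apply, one_mul] at h
  rw [← h, revVandermonde]
  congr 1
  ext i j
  simp only [Matrix.of_apply, Matrix.projVandermonde_apply, Pi.one_apply, one_pow, one_mul,
    Fin.val_rev]
  congr 1
  omega

lemma revVandermonde_ne_zero {n : ℕ} {x : Fin n → ℂ} (hx : Function.Injective x) :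
    revVandermonde x ≠ 0 := by
  rw [revVandermonde_eq_prod]
  refine prod_ne_zero_iff.2 fun i _ => prod_ne_zero_iff.2 fun j hj => ?_
  exact sub_ne_zero.2 (hx.ne (mem_Ioi.1 hj).ne)

lemma revVandermonde_succAbove {n : ℕ} (x : Fin (n + 1) → ℂ) (p : Fin (n + 1)) :
    revVandermonde x = (-1) ^ (p : ℕ) * (∏ l, (x p - x (p.succAbove l))) *
      revVandermonde (x ∘ p.succAbove) := by
  have key : ∀ {m : ℕ} (y : Fin m → ℂ) (i : Fin m),
      ∏ j ∈ Ioi i, (y i - y j) = ∏ j, if i < j then y i - y j else 1 := by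
    intro m y i
    rw [← prod_filter]
    congr 1
    ext j
    simp
  have sign : (-1 : ℂ) ^ (p : ℕ) = ∏ l : Fin n, if p.succAbove l < p then -1 else 1 := by
    have hle : (p : ℕ) ≤ n := Nat.lt_succ_iff.1 p.2
    simp_rw [Fin.succAbove_lt_iff_castSucc_lt, Fin.lt_def, Fin.val_castSucc]
    rw [Fin.prod_univ_eq_prod_range (fun l => if l < (p : ℕ) then (-1 : ℂ) else 1) n,
      ← prod_filter, prod_const]
    congr 1
    rw [show (range n).filter (fun l => l < (p : ℕ)) = range p by
      ext l; simp only [mem_filter, mem_range]; omega, card_range]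
  rw [revVandermonde_eq_prod, revVandermonde_eq_prod, sign]
  simp_rw [key x, key (x ∘ p.succAbove)]
  rw [Fin.prod_univ_succAbove _ p, Fin.prod_univ_succAbove _ p]
  simp_rw [Fin.prod_univ_succAbove (fun j => if _ < j then x _ - x j else 1) p]
  rw [prod_mul_distrib, if_neg (lt_irrefl p), one_mul]
  simp_rw [(Fin.strictMono_succAbove p).lt_iff_lt, Function.comp_apply]
  rw [← mul_assoc]
  congr 1
  rw [← prod_mul_distrib, ← prod_mul_distrib]
  refine prod_congr rfl fun l _ => ?_
  rcases lt_or_gt_of_ne (Fin.succAbove_ne p l) with h | h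
  · rw [if_neg h.not_gt, if_pos h, if_pos h]; ring
  · rw [if_pos h, if_neg h.not_gt, if_neg h.not_gt]; ring

lemma sum_bool_succAbove {n : ℕ} (p : Fin (n + 1)) (f : (Fin (n + 1) → Bool) → ℂ) :
    ∑ ε, f ε = ∑ ε : Fin n → Bool, (f (p.insertNth true ε) + f (p.insertNth false ε)) := by
  rw [← (Fin.insertNthEquiv (fun _ => Bool) p).sum_comp, Fintype.sum_prod_type,
    Fintype.sum_bool, ← sum_add_distrib]
  rfl

/-- Lagrange interpolation at the nodes `-y i`. -/
lemma prod_add_sub_prod_eq_sum_aux {ι : Type*} [DecidableEq ι] (S : Finset ι) (y : ι → ℂ)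
    (hy : Set.InjOn y S) (hy0 : ∀ i ∈ S, y i ≠ 0) (v : ℂ) :
    ∏ i ∈ S, (v + y i) - ∏ i ∈ S, y i * (1 + v * y i) =
      ∑ i ∈ S, v * (1 - y i ^ 2) *
        ∏ l ∈ S.erase i, (v + y l) * (1 - y i * y l) * (y l / (y l - y i)) := by
  open Polynomial in
  let P : ℂ[X] := ∏ i ∈ S, (X + C (y i)) - ∏ i ∈ S, C (y i) * (1 + X * C (y i))
  have hP : ∀ t, P.eval t = ∏ i ∈ S, (t + y i) - ∏ i ∈ S, y i * (1 + t * y i) := by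
    intro t
    simp [P, Polynomial.eval_prod, mul_comm t]
  have hP0 : P.coeff 0 = 0 := by
    rw [Polynomial.coeff_zero_eq_eval_zero, hP]
    simp
  have hQ : ∀ t, P.eval t = P.divX.eval t * t := by
    intro t
    conv_lhs => rw [← Polynomial.divX_mul_X_add P, hP0]
    simp
  have hdeg : P.degree ≤ S.card := by
    refine (Polynomial.degree_sub_le _ _).trans (max_le ?_ ?_)
    · refine (Polynomial.degree_prod_le _ _).trans ?_
      refine (sum_le_sum fun i _ => (Polynomial.degree_X_add_C (y i)).le).trans ?_
      simp
    · refine (Polynomial.degree_prod_le _ _).trans ?_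
      refine (sum_le_sum (g := fun _ => 1) fun i _ => ?_).trans ?_
      · compute_degree
      · simp
  have hQdeg : P.divX.degree < S.card := by
    by_cases h : P = 0
    · simp [h]
    · exact (Polynomial.degree_divX_lt h).trans_le hdeg
  have hinj : Set.InjOn (fun i => -y i) S := fun i hi j hj h => hy hi hj (neg_injective h)
  have hint := Lagrange.eq_interpolate hinj hQdeg
  rw [← hP, hQ, hint, Lagrange.interpolate_apply, Polynomial.eval_finsetSum, sum_mul]
  refine sum_congr rfl fun i hi => ?_
  have hval : P.divX.eval (-y i) = (1 - y i ^ 2) * ∏ l ∈ S.erase i, (y l * (1 - y i * y l)) := by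
    have h := hQ (-y i)
    rw [hP, prod_eq_zero hi (by ring), ← mul_prod_erase S _ hi] at h
    refine mul_right_cancel₀ (neg_ne_zero.2 (hy0 i hi)) (h.symm.trans ?_)
    rw [prod_congr rfl fun l _ => show y l * (1 + -y i * y l) = y l * (1 - y i * y l) by ring]
    ring
  rw [hval, Polynomial.eval_mul, Polynomial.eval_C, Lagrange.basis, Polynomial.eval_prod]
  simp only [Lagrange.basisDivisor, Polynomial.eval_mul, Polynomial.eval_C, Polynomial.eval_sub,
    Polynomial.eval_X]
  rw [mul_assoc (1 - y i ^ 2), ← prod_mul_distrib, mul_right_comm, mul_comm _ v]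
  congr 1
  refine prod_congr rfl fun l _ => ?_
  rw [show -y i - -y l = y l - y i by ring, div_eq_mul_inv]
  ring

lemma prod_add_sub_prod_eq_sum {ι : Type*} [DecidableEq ι] (S : Finset ι) (y : ι → ℂ)
    (hy : Set.InjOn y S) (hy0 : ∀ i ∈ S, y i ≠ 0) (v w : ℂ) :
    ∏ i ∈ S, (v + w * y i) - ∏ i ∈ S, y i * (w + v * y i) =
      ∑ i ∈ S, v * (1 - y i ^ 2) *
        ∏ l ∈ S.erase i, (v + w * y l) * (1 - y i * y l) * (y l / (y l - y i)) := by
  refine congrFun (Continuous.ext_on (dense_compl_singleton (0 : ℂ))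
    (f := fun w => ∏ i ∈ S, (v + w * y i) - ∏ i ∈ S, y i * (w + v * y i))
    (g := fun w => ∑ i ∈ S, v * (1 - y i ^ 2) *
        ∏ l ∈ S.erase i, (v + w * y l) * (1 - y i * y l) * (y l / (y l - y i)))
    (by fun_prop) (by fun_prop) fun w hw => ?_) w
  have hw : w ≠ 0 := hw
  have h := congrArg (w ^ S.card * ·) (prod_add_sub_prod_eq_sum_aux S y hy hy0 (v / w))
  simp only [mul_sum, ← prod_const] at h
  rw [mul_sub, ← prod_mul_distrib, ← prod_mul_distrib] at h
  simp only
  convert h using 2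
  · refine prod_congr rfl fun i _ => ?_
    field_simp
  · refine prod_congr rfl fun i _ => ?_
    field_simp
  · rename_i i hi
    rw [← mul_prod_erase S _ hi, show w * (∏ _ ∈ S.erase i, w) * (v / w * (1 - y i ^ 2) *
      ∏ l ∈ S.erase i, (v / w + y l) * (1 - y i * y l) * (y l / (y l - y i))) =
      (w * (v / w)) * (1 - y i ^ 2) * ((∏ _ ∈ S.erase i, w) *
      ∏ l ∈ S.erase i, (v / w + y l) * (1 - y i * y l) * (y l / (y l - y i))) by ring,
      ← prod_mul_distrib, mul_div_cancel₀ _ hw]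
    congr 1
    refine prod_congr rfl fun l _ => ?_
    rw [← mul_assoc, ← mul_assoc, mul_add, mul_div_cancel₀ _ hw]

/-- `t` or `t⁻¹`, according to the sign `b`. -/
def signedPow (b : Bool) (t : ℂ) : ℂ := if b then t else t⁻¹

/-- The denominator `∏_{i ≤ j} (1 - z_i z_j)`. -/
def pairDenom {n : ℕ} (z : Fin n → ℂ) : ℂ := ∏ i, ∏ j ∈ Ici i, (1 - z i * z j)

/-- The numerator factor of a coordinate of sign `b`, for partitions with all parts `< M`. -/
def boundFactor (u : ℂ) (M : ℕ) (b : Bool) (t : ℂ) : ℂ :=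
  if b then 1 + t * u else t ^ M * t⁻¹ ^ 2 * if Even M then 1 + t * u else u + t

/-- The sum over sign vectors, for partitions with all parts `< M`. -/
def signSum (u : ℂ) (M : ℕ) {n : ℕ} (x : Fin n → ℂ) : ℂ :=
  ∑ ε : Fin n → Bool, (∏ j, boundFactor u M (ε j) (x j)) / pairDenom fun j => signedPow (ε j) (x j)

/-- Nonzero, pairwise distinct values, no two of which (with repetition) are mutually inverse. -/
structure IsGeneric {n : ℕ} (x : Fin n → ℂ) : Prop where
  ne_zero : ∀ i, x i ≠ 0
  injective : Function.Injective x
  mul_ne_one : ∀ i j, x i * x j ≠ 1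

namespace IsGeneric

variable {n : ℕ} {x : Fin n → ℂ}

lemma comp_succAbove {x : Fin (n + 1) → ℂ} (hx : IsGeneric x) (p : Fin (n + 1)) :
    IsGeneric (x ∘ p.succAbove) :=
  ⟨fun _ => hx.ne_zero _, hx.injective.comp Fin.succAbove_right_injective,
    fun _ _ => hx.mul_ne_one _ _⟩

lemma mul_inv_ne_one (hx : IsGeneric x) {i j : Fin n} (h : i ≠ j) : x i * (x j)⁻¹ ≠ 1 := by
  rw [← div_eq_mul_inv, Ne, div_eq_one_iff_eq (hx.ne_zero j)]
  exact hx.injective.ne h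

lemma inv_mul_inv_ne_one (hx : IsGeneric x) (i j : Fin n) : (x i)⁻¹ * (x j)⁻¹ ≠ 1 := by
  rw [← mul_inv, Ne, inv_eq_one]
  exact hx.mul_ne_one i j

lemma mul_signedPow_ne_one (hx : IsGeneric x) (b : Bool) {i j : Fin n} (h : i ≠ j) :
    x i * signedPow b (x j) ≠ 1 := by
  cases b
  · exact hx.mul_inv_ne_one h
  · exact hx.mul_ne_one i j

lemma inv_mul_signedPow_ne_one (hx : IsGeneric x) (b : Bool) {i j : Fin n} (h : i ≠ j) :
    (x i)⁻¹ * signedPow b (x j) ≠ 1 := by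
  cases b
  · exact hx.inv_mul_inv_ne_one i j
  · simpa only [signedPow, if_true, mul_comm] using hx.mul_inv_ne_one h.symm

lemma signedPow_mul_signedPow_ne_one (hx : IsGeneric x) (b c : Bool) {i j : Fin n} (h : i ≠ j) :
    signedPow b (x i) * signedPow c (x j) ≠ 1 := by
  cases b
  · exact hx.inv_mul_signedPow_ne_one c h
  · exact hx.mul_signedPow_ne_one c h

lemma signedPow_ne_zero (hx : IsGeneric x) (b : Bool) (i : Fin n) : signedPow b (x i) ≠ 0 := by
  cases b
  · exact inv_ne_zero (hx.ne_zero i)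
  · exact hx.ne_zero i

lemma signedPow_mul_self_ne_one (hx : IsGeneric x) (b : Bool) (i : Fin n) :
    signedPow b (x i) * signedPow b (x i) ≠ 1 := by
  cases b
  · exact hx.inv_mul_inv_ne_one i i
  · exact hx.mul_ne_one i i

lemma pairDenom_ne_zero (hx : IsGeneric x) (ε : Fin n → Bool) :
    pairDenom (fun j => signedPow (ε j) (x j)) ≠ 0 := by
  refine prod_ne_zero_iff.2 fun i _ => prod_ne_zero_iff.2 fun j _ => sub_ne_zero.2 (Ne.symm ?_)
  rcases eq_or_ne i j with rfl | h
  · exact hx.signedPow_mul_self_ne_one _ i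
  · exact hx.signedPow_mul_signedPow_ne_one _ _ h

end IsGeneric

lemma pairDenom_succAbove {n : ℕ} (z : Fin (n + 1) → ℂ) (p : Fin (n + 1)) :
    pairDenom z = ((1 - z p * z p) * ∏ l, (1 - z p * z (p.succAbove l))) *
      pairDenom fun l => z (p.succAbove l) :=
  prod_Ici_succAbove (fun i j => 1 - z i * z j) (fun i j => by rw [mul_comm]) p

/-- The weight `u ^ [M odd]` of a part of size `M`. -/
def parityWeight (u : ℂ) (M : ℕ) : ℂ := if Odd M then u else 1

lemma boundFactor_succ_false (u : ℂ) (M : ℕ) {t : ℂ} (ht : t ≠ 0) :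
    boundFactor u (M + 1) false t =
      t ^ M * (parityWeight u M + parityWeight u (M + 1) * t⁻¹) := by
  rcases Nat.even_or_odd M with h | h
  · have h1 : ¬ Even (M + 1) := Nat.not_even_iff_odd.2 h.add_one
    simp [boundFactor, parityWeight, h1, h.add_one, Nat.not_odd_iff_even.2 h]
    field_simp
    ring
  · simp [boundFactor, parityWeight, h.add_one, h, Nat.not_odd_iff_even.2 h.add_one]
    field_simp
    ring

lemma boundFactor_false (u : ℂ) (M : ℕ) {t : ℂ} (ht : t ≠ 0) :
    boundFactor u M false t =
      t ^ M * (t⁻¹ * (parityWeight u (M + 1) + parityWeight u M * t⁻¹)) := by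
  rcases Nat.even_or_odd M with h | h
  · simp [boundFactor, parityWeight, h, h.add_one, Nat.not_odd_iff_even.2 h]
    field_simp
    ring
  · simp [boundFactor, parityWeight, Nat.not_even_iff_odd.2 h, h, Nat.not_odd_iff_even.2 h.add_one]
    field_simp
    rw [add_comm]

lemma prod_univ_succAbove_eq_prod_erase {n : ℕ} (p : Fin (n + 1)) (g : Fin (n + 1) → ℂ) :
    ∏ l, g (p.succAbove l) = ∏ l ∈ univ.erase p, g l := by
  have h : (univ.erase p) = univ.map p.succAboveEmb := by
    ext l
    simp [Fin.exists_succAbove_eq_iff]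
  rw [h, prod_map]
  rfl

lemma prod_boundFactor_succ_sub {n : ℕ} (u : ℂ) (M : ℕ) {x : Fin (n + 1) → ℂ}
    (hx : IsGeneric x) (ε : Fin (n + 1) → Bool) :
    ∏ j, boundFactor u (M + 1) (ε j) (x j) - ∏ j, boundFactor u M (ε j) (x j) =
      ∑ i, if ε i then 0 else parityWeight u M * x i ^ M * (1 - (x i)⁻¹ * (x i)⁻¹) *
        ∏ l, boundFactor u (M + 1) (ε (i.succAbove l)) (x (i.succAbove l)) *
          ((1 - (x i)⁻¹ * signedPow (ε (i.succAbove l)) (x (i.succAbove l))) /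
            (1 - (x i)⁻¹ * x (i.succAbove l))) := by
  set S := univ.filter fun i => ε i = false with hS
  have hmem : ∀ {i}, i ∈ S ↔ ε i = false := by simp [hS]
  have hcompl : ∀ {i}, i ∈ Sᶜ ↔ ε i = true := by simp [hS]
  have split (K : ℕ) : ∏ j, boundFactor u K (ε j) (x j) =
      (∏ j ∈ S, boundFactor u K false (x j)) * ∏ j ∈ Sᶜ, (1 + x j * u) := by
    rw [← prod_mul_prod_compl S]
    congr 1
    · exact prod_congr rfl fun j hj => by rw [hmem.1 hj]
    · exact prod_congr rfl fun j hj => by rw [hcompl.1 hj]; rfl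
  have key := prod_add_sub_prod_eq_sum S (fun i => (x i)⁻¹)
    (fun i _ j _ h => hx.injective (inv_injective h)) (fun i _ => inv_ne_zero (hx.ne_zero i))
    (parityWeight u M) (parityWeight u (M + 1))
  rw [split, split, prod_congr rfl fun j _ => boundFactor_succ_false u M (hx.ne_zero j),
    prod_congr rfl fun j _ => boundFactor_false u M (hx.ne_zero j), prod_mul_distrib,
    prod_mul_distrib, ← sub_mul, ← mul_sub, key, mul_sum, sum_mul,
    ← sum_filter_add_sum_filter_not univ (fun i => ε i = false), ← hS,
    sum_eq_zero (s := univ.filter fun i => ¬ ε i = false) fun i hi => by simp_all, add_zero]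
  refine sum_congr rfl fun i hi => ?_
  have hsplit : univ.erase i = (S.erase i).disjUnion Sᶜ
      (disjoint_left.2 fun l hl hl' => mem_compl.1 hl' (mem_of_mem_erase hl)) := by
    ext l
    by_cases hl : l = i
    · simp [hl, hi]
    · simp [hl, em]
  rw [if_neg (by simp [hmem.1 hi]), prod_univ_succAbove_eq_prod_erase i fun l =>
    boundFactor u (M + 1) (ε l) (x l) *
      ((1 - (x i)⁻¹ * signedPow (ε l) (x l)) / (1 - (x i)⁻¹ * x l)), hsplit, prod_disjUnion,
    ← mul_assoc (parityWeight u M * x i ^ M * (1 - (x i)⁻¹ * (x i)⁻¹))]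
  congr 1
  · rw [← mul_prod_erase S _ hi]
    rw [show ∀ a b c d e : ℂ, a * b * (c * d * e) = c * a * d * (b * e) from
        fun _ _ _ _ _ => by ring,
      ← prod_mul_distrib, sq]
    congr 1
    refine prod_congr rfl fun l hl => ?_
    obtain ⟨hli, hl⟩ := mem_erase.1 hl
    rw [hmem.1 hl, boundFactor_succ_false u M (hx.ne_zero l)]
    have h0 := hx.ne_zero l
    have h1 := hx.ne_zero i
    have h2 : x i - x l ≠ 0 := sub_ne_zero.2 (hx.injective.ne (Ne.symm hli))
    have h3 : (x l)⁻¹ / ((x l)⁻¹ - (x i)⁻¹) = 1 / (1 - (x i)⁻¹ * x l) := by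
      rw [show (x l)⁻¹ - (x i)⁻¹ = (x i - x l) / (x l * x i) by field_simp,
        show 1 - (x i)⁻¹ * x l = (x i - x l) / x i by field_simp]
      field_simp
    rw [h3, signedPow, if_neg Bool.false_ne_true]
    ring
  · refine prod_congr rfl fun l hl => ?_
    have hli : i ≠ l := fun h => mem_compl.1 hl (h ▸ hi)
    have h : 1 - (x i)⁻¹ * x l ≠ 0 :=
      sub_ne_zero.2 (hx.inv_mul_signedPow_ne_one true hli).symm
    rw [hcompl.1 hl, show signedPow true (x l) = x l from rfl, div_self h, mul_one]
    rfl

lemma signSum_succ_sub {n : ℕ} (u : ℂ) (M : ℕ) {x : Fin (n + 1) → ℂ} (hx : IsGeneric x) :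
    signSum u (M + 1) x - signSum u M x =
      ∑ i, parityWeight u M * x i ^ (M + n) * signSum u (M + 1) (x ∘ i.succAbove) /
        ∏ l, (x i - x (i.succAbove l)) := by
  rw [signSum, signSum, ← sum_sub_distrib]
  simp_rw [← sub_div, prod_boundFactor_succ_sub u M hx, sum_div]
  rw [sum_comm]
  refine sum_congr rfl fun i _ => ?_
  rw [sum_bool_succAbove i, signSum, mul_sum, sum_div]
  refine sum_congr rfl fun ε _ => ?_
  have hD := (hx.comp_succAbove i).pairDenom_ne_zero ε
  have h1 : 1 - (x i)⁻¹ * (x i)⁻¹ ≠ 0 := sub_ne_zero.2 (hx.inv_mul_inv_ne_one i i).symm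
  have h2 : ∏ l, (1 - (x i)⁻¹ * signedPow (ε l) (x (i.succAbove l))) ≠ 0 :=
    prod_ne_zero_iff.2 fun l _ => sub_ne_zero.2
      (hx.inv_mul_signedPow_ne_one _ (Fin.succAbove_ne i l).symm).symm
  have h3 : ∏ l, (x i - x (i.succAbove l)) = x i ^ n * ∏ l, (1 - (x i)⁻¹ * x (i.succAbove l)) := by
    rw [← Fin.prod_const, ← prod_mul_distrib]
    refine prod_congr rfl fun l _ => ?_
    have := hx.ne_zero i
    field_simp
  have h4 : ∏ l, (1 - (x i)⁻¹ * x (i.succAbove l)) ≠ 0 :=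
    prod_ne_zero_iff.2 fun l _ => sub_ne_zero.2
      (hx.inv_mul_signedPow_ne_one true (Fin.succAbove_ne i l).symm).symm
  have h5 := pow_ne_zero n (hx.ne_zero i)
  rw [pairDenom_succAbove _ i, pairDenom_succAbove _ i]
  simp only [Fin.insertNth_apply_same, Fin.insertNth_apply_succAbove, if_true, zero_div, zero_add,
    Bool.false_eq_true, if_false, prod_mul_distrib, prod_div_distrib, h3]
  rw [show signedPow false (x i) = (x i)⁻¹ from rfl, pow_add]
  simp only [Function.comp_apply] at hD ⊢
  generalize pairDenom _ = D at *
  generalize ∏ l, (1 - (x i)⁻¹ * signedPow (ε l) (x (i.succAbove l))) = A at *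
  generalize 1 - (x i)⁻¹ * (x i)⁻¹ = B at *
  generalize ∏ l, (1 - (x i)⁻¹ * x (i.succAbove l)) = E at *
  field_simp

lemma inv_prod_one_sub_mul {n : ℕ} {z : Fin (n + 1) → ℂ} (hz : Function.Injective z)
    (hz0 : ∀ i, z i ≠ 0) {t : ℂ} (ht : ∀ i, t * z i ≠ 1) :
    (∏ l, (1 - t * z l))⁻¹ =
      ∑ l, (1 - t * z l)⁻¹ * ∏ m, (1 - z (l.succAbove m) * (z l)⁻¹)⁻¹ := by
  have h := congrArg (Polynomial.eval t) (Lagrange.sum_basis (s := univ) (v := fun i => (z i)⁻¹)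
    (fun i _ j _ h => hz (inv_injective h)) univ_nonempty)
  rw [Polynomial.eval_finsetSum, Polynomial.eval_one] at h
  refine (mul_one _).symm.trans ((congrArg (_ * ·) h.symm).trans ?_)
  rw [mul_sum]
  refine sum_congr rfl fun l _ => ?_
  rw [Fin.prod_univ_succAbove _ l, mul_inv, mul_assoc, Lagrange.basis, Polynomial.eval_prod,
    ← prod_univ_succAbove_eq_prod_erase l
      fun m => Polynomial.eval t (Lagrange.basisDivisor (z l)⁻¹ (z m)⁻¹),
    ← prod_inv_distrib, ← prod_mul_distrib]
  congr 1
  refine prod_congr rfl fun m _ => ?_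
  simp only [Lagrange.basisDivisor, Polynomial.eval_mul, Polynomial.eval_C, Polynomial.eval_sub,
    Polynomial.eval_X]
  have h0 := hz0 l
  have h1 := hz0 (l.succAbove m)
  have h2 : 1 - t * z (l.succAbove m) ≠ 0 := sub_ne_zero.2 (ht _).symm
  have h3 : z (l.succAbove m) - z l ≠ 0 := sub_ne_zero.2 (hz.ne (Fin.succAbove_ne l m))
  rw [show (z l)⁻¹ - (z (l.succAbove m))⁻¹ =
      (z (l.succAbove m) - z l) / (z l * z (l.succAbove m)) by field_simp,
    show t - (z (l.succAbove m))⁻¹ = -(1 - t * z (l.succAbove m)) / z (l.succAbove m) by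
      field_simp; ring,
    show 1 - z (l.succAbove m) * (z l)⁻¹ = -(z (l.succAbove m) - z l) / z l by field_simp; ring]
  generalize 1 - t * z (l.succAbove m) = a at *
  field_simp

/-- The summand of `signSum u 0 x`. -/
def emptyTerm (u : ℂ) {n : ℕ} (x : Fin n → ℂ) (ε : Fin n → Bool) : ℂ :=
  (∏ j, boundFactor u 0 (ε j) (x j)) / pairDenom fun j => signedPow (ε j) (x j)

lemma emptyTerm_insertNth (u : ℂ) {n : ℕ} {x : Fin (n + 1) → ℂ} (hx : IsGeneric x)
    (p : Fin (n + 1)) (b : Bool) (ε : Fin n → Bool) :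
    emptyTerm u x (p.insertNth b ε) = (if b then 1 else -1) *
      ((1 + x p * u) / (1 - x p * x p)) *
      (∏ l, (1 - signedPow b (x p) * signedPow (ε l) (x (p.succAbove l))))⁻¹ *
      emptyTerm u (x ∘ p.succAbove) ε := by
  have key : boundFactor u 0 b (x p) / (1 - signedPow b (x p) * signedPow b (x p)) =
      (if b then 1 else -1) * ((1 + x p * u) / (1 - x p * x p)) := by
    cases b
    · have h0 := hx.ne_zero p
      have h1 : 1 - x p * x p ≠ 0 := sub_ne_zero.2 (hx.mul_ne_one p p).symm
      have h2 : 1 - (x p)⁻¹ * (x p)⁻¹ = -(1 - x p * x p) / (x p * x p) := by field_simp; ring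
      simp only [boundFactor, signedPow, Bool.false_eq_true, if_false, Even.zero, if_true, h2]
      generalize 1 - x p * x p = a at *
      field_simp
    · simp [boundFactor, signedPow]
  rw [emptyTerm, pairDenom_succAbove _ p, Fin.prod_univ_succAbove _ p]
  simp only [Fin.insertNth_apply_same, Fin.insertNth_apply_succAbove]
  rw [← key, emptyTerm]
  simp only [Function.comp_apply, div_eq_mul_inv, mul_inv]
  ring

/-- There are no partitions with a positive number of parts, all negative. -/
lemma signSum_zero (u : ℂ) {n : ℕ} {x : Fin (n + 1) → ℂ} (hx : IsGeneric x) :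
    signSum u 0 x = 0 := by
  change ∑ ε, emptyTerm u x ε = 0
  rw [sum_bool_succAbove 0]
  simp_rw [emptyTerm_insertNth u hx]
  rcases n with _ | n
  · simp
  have hw := hx.comp_succAbove 0
  set w := x ∘ (0 : Fin (n + 2)).succAbove with hwdef
  have hxw (l : Fin (n + 1)) : x ((0 : Fin (n + 2)).succAbove l) = w l := rfl
  simp_rw [hxw]
  have hinj (ε : Fin (n + 1) → Bool) : Function.Injective fun l => signedPow (ε l) (w l) := by
    intro i j hij
    by_contra hne
    refine hw.signedPow_mul_signedPow_ne_one (ε i) (!ε j) hne ?_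
    have h0 := hw.signedPow_ne_zero (ε j) j
    have h1 : signedPow (!ε j) (w j) = (signedPow (ε j) (w j))⁻¹ := by
      cases ε j <;> simp [signedPow]
    simp only at hij
    rw [hij, h1, mul_inv_cancel₀ h0]
  have hpf (b : Bool) (ε : Fin (n + 1) → Bool) :=
    inv_prod_one_sub_mul (hinj ε) (fun i => hw.signedPow_ne_zero _ i) (t := signedPow b (x 0))
      fun i => hx.signedPow_mul_signedPow_ne_one b (ε i) (Fin.succAbove_ne 0 i).symm
  simp_rw [hpf, mul_sum, sum_mul, ← sum_add_distrib]
  rw [sum_comm]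
  refine sum_eq_zero fun l _ => ?_
  rw [sum_bool_succAbove l]
  refine sum_eq_zero fun ε _ => ?_
  simp only [Fin.insertNth_apply_same, Fin.insertNth_apply_succAbove, emptyTerm_insertNth u hw]
  simp only [signedPow, if_true, Bool.false_eq_true, if_false, inv_inv, prod_inv_distrib,
    mul_comm _ (w l), mul_comm _ (w l)⁻¹]
  have h0 := hx.ne_zero 0
  have h1 := hw.ne_zero l
  have h2 : 1 - w l * x 0 ≠ 0 :=
    sub_ne_zero.2 (hx.mul_ne_one _ 0).symm
  have hl : (0 : Fin (n + 2)).succAbove l ≠ 0 := Fin.succAbove_ne 0 l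
  have h3 : x 0 - w l ≠ 0 := sub_ne_zero.2 (hx.injective.ne hl.symm)
  have key : (1 - w l * x 0)⁻¹ - (1 - w l * (x 0)⁻¹)⁻¹ =
      (1 - (w l)⁻¹ * x 0)⁻¹ - (1 - (w l)⁻¹ * (x 0)⁻¹)⁻¹ := by
    rw [show 1 - w l * (x 0)⁻¹ = (x 0 - w l) / x 0 by field_simp,
      show 1 - (w l)⁻¹ * x 0 = -(x 0 - w l) / w l by field_simp; ring,
      show 1 - (w l)⁻¹ * (x 0)⁻¹ = -(1 - w l * x 0) / (w l * x 0) by field_simp; ring]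
    field_simp
    ring
  linear_combination ((1 + x 0 * u) / (1 - x 0 * x 0)) * ((1 + w l * u) / (1 - w l * w l)) *
    (∏ m, (1 - w l * if ε m = true then w (l.succAbove m) else (w (l.succAbove m))⁻¹))⁻¹ *
    (∏ m, (1 - (w l)⁻¹ * if ε m = true then w (l.succAbove m) else (w (l.succAbove m))⁻¹))⁻¹ *
    emptyTerm u (w ∘ l.succAbove) ε * key

open Classical in
/-- Partitions with at most `n` parts, all of them `< M`. -/
def boundedPartitions (n M : ℕ) : Finset (Fin n → ℕ) :=
  (Fintype.piFinset fun _ => range M).filter Antitone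

lemma mem_boundedPartitions {n M : ℕ} {lam : Fin n → ℕ} :
    lam ∈ boundedPartitions n M ↔ (∀ i, lam i < M) ∧ Antitone lam := by
  simp [boundedPartitions]

lemma sum_boundedPartitions_succ (n M : ℕ) (f : (Fin (n + 1) → ℕ) → ℂ) :
    ∑ lam ∈ boundedPartitions (n + 1) (M + 1), f lam =
      ∑ lam ∈ boundedPartitions (n + 1) M, f lam +
        ∑ lam ∈ boundedPartitions n (M + 1), f (Fin.cons M lam) := by
  classical
  have hinj : Function.Injective fun lam : Fin n → ℕ => (Fin.cons M lam : Fin (n + 1) → ℕ) :=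
    Fin.cons_right_injective (α := fun _ => ℕ) M
  rw [← sum_image (f := f) hinj.injOn, ← sum_union]
  · congr 1
    ext lam
    simp only [mem_union, mem_image, mem_boundedPartitions]
    constructor
    · rintro ⟨hlt, hanti⟩
      rcases (Nat.lt_succ_iff.1 (hlt 0)).lt_or_eq with h | h
      · exact Or.inl ⟨fun i => (hanti (Fin.zero_le i)).trans_lt h, hanti⟩
      · refine Or.inr ⟨Fin.tail lam, ⟨fun i => hlt _, fun i j hij =>
          hanti (Fin.succ_le_succ_iff.2 hij)⟩, ?_⟩
        rw [← h, Fin.cons_self_tail]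
    · rintro (⟨hlt, hanti⟩ | ⟨mu, ⟨hlt, hanti⟩, rfl⟩)
      · exact ⟨fun i => (hlt i).trans M.lt_succ_self, hanti⟩
      · refine ⟨Fin.cases M.lt_succ_self hlt, fun i j hij => ?_⟩
        induction j using Fin.cases with
        | zero => rw [Fin.le_zero_iff.1 hij]
        | succ j =>
          induction i using Fin.cases with
          | zero => exact Nat.lt_succ_iff.1 (hlt j)
          | succ i => exact hanti (Fin.succ_le_succ_iff.1 hij)
  · rw [disjoint_left]
    rintro lam h1 h2
    obtain ⟨mu, -, rfl⟩ := mem_image.1 h2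
    exact lt_irrefl _ ((mem_boundedPartitions.1 h1).1 0)

/-- The sum of weighted alternants over the partitions with all parts `< M`. -/
def alternantSum (u : ℂ) (M : ℕ) {n : ℕ} (x : Fin n → ℂ) : ℂ :=
  ∑ lam ∈ boundedPartitions n M, (∏ i, parityWeight u (lam i)) *
    Matrix.det (Matrix.of fun i j : Fin n => x i ^ (lam j + (n - 1 - (j : ℕ))))

lemma alternantSum_succ (u : ℂ) (M : ℕ) {n : ℕ} (x : Fin (n + 1) → ℂ) :
    alternantSum u (M + 1) x = alternantSum u M x +
      ∑ i : Fin (n + 1), (-1) ^ (i : ℕ) * parityWeight u M * x i ^ (M + n) *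
        alternantSum u (M + 1) (x ∘ i.succAbove) := by
  rw [alternantSum, sum_boundedPartitions_succ]
  congr 1
  simp_rw [alternantSum, mul_sum]
  rw [sum_comm]
  refine sum_congr rfl fun lam _ => ?_
  rw [Matrix.det_succ_column_zero, mul_sum]
  refine sum_congr rfl fun i _ => ?_
  have hsub : (Matrix.of fun i j : Fin (n + 1) =>
      x i ^ ((Fin.cons M lam : Fin (n + 1) → ℕ) j + (n + 1 - 1 - (j : ℕ)))).submatrix
        i.succAbove Fin.succ =
      Matrix.of fun a b : Fin n => (x ∘ i.succAbove) a ^ (lam b + (n - 1 - (b : ℕ))) := by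
    ext a b
    simp only [Matrix.submatrix_apply, Matrix.of_apply, Fin.cons_succ, Fin.val_succ,
      Function.comp_apply]
    congr 2
    omega
  rw [hsub, Fin.prod_univ_succ]
  simp only [Matrix.of_apply, Fin.cons_zero, Fin.cons_succ, Fin.val_zero, Nat.add_sub_cancel,
    Nat.sub_zero]
  ring

lemma alternantSum_eq (u : ℂ) {n : ℕ} {x : Fin n → ℂ} (hx : IsGeneric x) (M : ℕ) :
    alternantSum u M x = revVandermonde x * signSum u M x := by
  induction n generalizing M with
  | zero =>
    have h : boundedPartitions 0 M = {default} := by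
      ext lam
      simp [mem_boundedPartitions, Subsingleton.elim lam default, Subsingleton.antitone]
    simp [alternantSum, revVandermonde, signSum, pairDenom, h]
  | succ n ih =>
    induction M with
    | zero =>
      have h : boundedPartitions (n + 1) 0 = ∅ := by
        ext lam
        simp [mem_boundedPartitions]
      rw [signSum_zero u hx, alternantSum, h, sum_empty, mul_zero]
    | succ M ihM =>
      rw [alternantSum_succ, ihM]
      refine (sub_eq_iff_eq_add'.1 ?_).symm
      rw [← mul_sub, signSum_succ_sub u M hx, mul_sum]
      refine sum_congr rfl fun i _ => ?_
      have h : ∏ l, (x i - x (i.succAbove l)) ≠ 0 := prod_ne_zero_iff.2 fun l _ =>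
        sub_ne_zero.2 (hx.injective.ne (Fin.succAbove_ne i l).symm)
      rw [ih (hx.comp_succAbove i), revVandermonde_succAbove x i]
      field_simp

/-- **Generalized Okada–Krattenthaler identity with odd-row marker.** For a complex
number `u` and nonzero, pairwise distinct `x_1, …, x_k` with `x_i x_j ≠ 1` for `i ≤ j`,
`∑_{λ ⊆ ⟨(2N)^k⟩} u^{r(λ)} s_λ(x_1, …, x_k)
  = ∑_{ε ∈ {±1}^k} (∏_j x_j^{N(1−ε_j)}) (∏_i (1 + x_i^{ε_i} u)) /
    (∏_{i ≤ j} (1 − x_i^{ε_i} x_j^{ε_j}))`,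
summed over partitions `λ` with at most `k` parts, each part at most `2N` (encoded as
antitone functions `Fin k → Fin (2N+1)`), `r(λ)` being the number of odd parts of `λ`. -/
theorem partition_schur_sum_odd_marker (N k : ℕ) (u : ℂ)
    (x : Fin k → ℂ) (hx0 : ∀ i, x i ≠ 0) (hxinj : Function.Injective x)
    (hx1 : ∀ i j : Fin k, i ≤ j → x i * x j ≠ 1) :
    (∑ lam ∈ Finset.univ.filter
        (fun lam : Fin k → Fin (2 * N + 1) => ∀ i j : Fin k, i ≤ j → lam j ≤ lam i),
        u ^ (Finset.univ.filter fun i : Fin k => Odd (lam i : ℕ)).card *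
          schur (fun i : Fin k => (lam i : ℕ)) x)
      = ∑ ε : Fin k → Bool,
          (∏ j : Fin k, x j ^ ((N : ℤ) * (1 - sg ε j))) *
          (∏ i : Fin k, (1 + x i ^ sg ε i * u)) /
          (∏ i : Fin k, ∏ j ∈ Finset.Ici i, (1 - x i ^ sg ε i * x j ^ sg ε j)) := by
  have hx : IsGeneric x := by
    refine ⟨hx0, hxinj, fun i j => ?_⟩
    rcases le_total i j with h | h
    · exact hx1 i j h
    · rw [mul_comm]
      exact hx1 j i h
  have hleft : (∑ lam ∈ Finset.univ.filter
      (fun lam : Fin k → Fin (2 * N + 1) => ∀ i j : Fin k, i ≤ j → lam j ≤ lam i),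
      u ^ (Finset.univ.filter fun i : Fin k => Odd (lam i : ℕ)).card *
        schur (fun i : Fin k => (lam i : ℕ)) x) =
      alternantSum u (2 * N + 1) x / revVandermonde x := by
    rw [alternantSum, sum_div]
    refine sum_bij (fun lam _ i => (lam i : ℕ)) ?_ ?_ ?_ ?_
    · intro lam h
      exact mem_boundedPartitions.2 ⟨fun i => (lam i).2, fun i j hij => (mem_filter.1 h).2 i j hij⟩
    · intro lam _ mu _ h
      ext i
      exact congrFun h i
    · intro lam h
      obtain ⟨hlt, hanti⟩ := mem_boundedPartitions.1 h
      exact ⟨fun i => ⟨lam i, hlt i⟩, mem_filter.2 ⟨mem_univ _, fun i j hij => hanti hij⟩, rfl⟩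
    · intro lam _
      rw [schur, ← mul_div_assoc]
      simp only [parityWeight]
      rw [← prod_filter, prod_const]
      rfl
  rw [hleft, alternantSum_eq u hx, mul_div_cancel_left₀ _ (revVandermonde_ne_zero hxinj), signSum]
  refine sum_congr rfl fun ε _ => ?_
  have hsg (j : Fin k) : x j ^ sg ε j = signedPow (ε j) (x j) := by
    cases h : ε j <;> simp [sg, signedPow, h]
  simp_rw [hsg]
  rw [← prod_mul_distrib]
  refine congrArg (· / _) (prod_congr rfl fun j _ => ?_)
  cases h : ε j
  · have hodd : ¬ Even (2 * N + 1) := by simp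
    have hj := hx0 j
    have hpow : x j ^ ((N : ℤ) * (1 - sg ε j)) = x j ^ (2 * N) := by
      rw [← zpow_natCast]
      congr 1
      simp only [sg, h, Bool.false_eq_true, if_false]
      push_cast
      ring
    rw [hpow]
    simp only [boundFactor, signedPow, Bool.false_eq_true, if_false, hodd]
    field_simp
    ring
  · simp [boundFactor, signedPow, sg, h]
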